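/- Let d ≥ 1, and adopt the stochastic Fourier advection–diffusion setup with diffusivity ν ∈ (0, e^{−1}], initial data g, mixing constants K ≥ 1, γ > 0, and asymptotic mass measure m. Suppose in addition there are a deterministic L ≥ 1 and a jointly measurable X : Ω × [0,∞) → [1,∞) such that almost surely |v_t(k)| ≤ X_t · 1_{|k| ≤ L} for all t and k, that almost surely t ↦ X_t is locally integrable, and that for some p ≥ 2, 𝔼 X_t^p ≤ 𝔼 X_0^p < ∞ for all t ≥ 0. Then there is a constant C ≥ 2, depending only on d, K, γ, L, and N₀, such that for every R with C ≤ R ≤ ν^{−1/2} / (C (log ν^{−1})^{1/2}) and every α > 0: μ_{C,R}( { r ∈ [C, R] : m([r, r+2L]) ≤ 2Lα / r } ) ≤ C^p (𝔼 X_0^p) α^{p−1}. -/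

import Mathlib

open MeasureTheory ENNReal Real Set
open scoped Classical

noncomputable section

/-- Euclidean norm of a lattice point `k ∈ ℤ^d`. -/
def znorm {d : ℕ} (k : Fin d → ℤ) : ℝ := Real.sqrt (∑ i, ((k i : ℝ)) ^ 2)

/-- Euclidean norm of a vector in `ℂ^d`. -/
def cnorm {d : ℕ} (z : Fin d → ℂ) : ℝ := Real.sqrt (∑ i, ‖z i‖ ^ 2)

/-- Pairing `k · z = Σ_i k_i z_i`. -/
def zdot {d : ℕ} (k : Fin d → ℤ) (z : Fin d → ℂ) : ℂ := ∑ i, (k i : ℂ) * z i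

/-- Divergence-free in Fourier variables: `k · v(k) = 0` for all `k`. -/
def DivFree {d : ℕ} (v : (Fin d → ℤ) → Fin d → ℂ) : Prop := ∀ k, zdot k (v k) = 0

/-- Fourier coefficients of a real vector field: `v(-k) = conj (v k)`. -/
def RealCoeff {d : ℕ} (v : (Fin d → ℤ) → Fin d → ℂ) : Prop :=
  ∀ k i, v (-k) i = starRingEnd ℂ (v k i)

/-- A weight: nondecreasing on `[0,∞)` with values in `[1,∞]`. -/
def IsWeight (w : ℝ → ℝ≥0∞) : Prop :=
  MonotoneOn w (Set.Ici 0) ∧ ∀ s, 0 ≤ s → 1 ≤ w s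

/-- Weighted ℓ¹ norm `‖w v‖_{ℓ¹} = Σ_k w(|k|)|v(k)|`. -/
def wl1 {d : ℕ} (w : ℝ → ℝ≥0∞) (v : (Fin d → ℤ) → Fin d → ℂ) : ℝ≥0∞ :=
  ∑' k, w (znorm k) * ENNReal.ofReal (cnorm (v k))

/-- `(w⁻¹ * m_a)(r) = Σ_k w(||k|-r|)⁻¹ |a(k)|²`. -/
def convMass {d : ℕ} (w : ℝ → ℝ≥0∞) (a : (Fin d → ℤ) → ℂ) (r : ℝ) : ℝ≥0∞ :=
  ∑' k, (w |znorm k - r|)⁻¹ * (‖a k‖₊ : ℝ≥0∞) ^ 2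

/-- `m_a(E) = Σ_{|k| ∈ E} |a(k)|²`. -/
def massOn {d : ℕ} (a : (Fin d → ℤ) → ℂ) (E : Set ℝ) : ℝ≥0∞ :=
  ∑' k, if znorm k ∈ E then (‖a k‖₊ : ℝ≥0∞) ^ 2 else 0

/-- Logarithmic density measure `μ_{a,b}(E)`. -/
def logDensity (a b : ℝ) (E : Set ℝ) : ℝ≥0∞ :=
  (ENNReal.ofReal (Real.log (b / a)))⁻¹ * ∫⁻ r in E ∩ Set.Icc a b, ENNReal.ofReal r⁻¹

/-- The right-hand side of the Fourier advection–diffusion system. -/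
def fourierRHS {d : ℕ} (ν : ℝ) (v : (Fin d → ℤ) → Fin d → ℂ) (a : (Fin d → ℤ) → ℂ)
    (k : Fin d → ℤ) : ℂ :=
  Complex.ofReal (-(4 * π ^ 2 * ν * znorm k ^ 2)) * a k
    - 2 * Complex.ofReal π * Complex.I * ∑' j, zdot k (v (k - j)) * a j


/-- The asymptotic mass measure `m(E) = 𝔼 ∫_0^∞ m_{a_t}(E) dt`. -/
def asymMass {d : ℕ} {Ω : Type*} [MeasurableSpace Ω] (ℙ : Measure Ω)
    (a : Ω → ℝ → (Fin d → ℤ) → ℂ) (E : Set ℝ) : ℝ≥0∞ :=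
  ∫⁻ ω, (∫⁻ t in Set.Ici (0 : ℝ), massOn (a ω t) E) ∂ℙ

/-- The stochastic Fourier advection–diffusion setup: measurability, a divergence-free
real velocity, initial data `g` of unit mass and zero mean, the Fourier-coefficient
advection–diffusion ODE, rapid decrease locally uniformly in time, and the
uniform-in-diffusivity exponential mixing bound. -/
def AdvectionSetup {d : ℕ} {Ω : Type*} [MeasurableSpace Ω] (ℙ : Measure Ω) (ν K γ : ℝ)
    (v : Ω → ℝ → (Fin d → ℤ) → Fin d → ℂ) (a : Ω → ℝ → (Fin d → ℤ) → ℂ)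
    (g : (Fin d → ℤ) → ℂ) : Prop :=
  (∀ k : Fin d → ℤ, Measurable fun p : Ω × ℝ => a p.1 p.2 k) ∧
  (∀ (k : Fin d → ℤ) (i : Fin d), Measurable fun p : Ω × ℝ => v p.1 p.2 k i) ∧
  g 0 = 0 ∧
  (∑' k : Fin d → ℤ, (‖g k‖₊ : ℝ≥0∞) ^ 2) = 1 ∧
  (∀ᵐ ω ∂ℙ,
    (∀ t : ℝ, 0 ≤ t → DivFree (v ω t) ∧ RealCoeff (v ω t)) ∧
    a ω 0 = g ∧
    (∀ (k : Fin d → ℤ), ∀ t ∈ Set.Ici (0 : ℝ),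
      HasDerivWithinAt (fun s => a ω s k) (fourierRHS ν (v ω t) (a ω t) k) (Set.Ici 0) t) ∧
    (∀ N : ℕ, ∀ T > (0 : ℝ), ∃ M : ℝ, ∀ t ∈ Set.Icc (0 : ℝ) T,
      ∑' k : Fin d → ℤ, ENNReal.ofReal ((1 + znorm k) ^ N) * (‖a ω t k‖₊ : ℝ≥0∞) ^ 2
        ≤ ENNReal.ofReal M)) ∧
  (∀ t : ℝ, 0 ≤ t →
    (∫⁻ ω, (∑' k : Fin d → ℤ, if k = 0 then 0 else
        (ENNReal.ofReal ((2 * π * znorm k) ^ 2))⁻¹ * (‖a ω t k‖₊ : ℝ≥0∞) ^ 2) ∂ℙ)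
      ≤ ENNReal.ofReal (K * Real.exp (-γ * t)))

section Lattice

variable {d : ℕ}

lemma znorm_eq_norm (k : Fin d → ℤ) :
    znorm k = ‖(WithLp.toLp 2 (fun i => (k i : ℝ)) : EuclideanSpace ℝ (Fin d))‖ := by
  simp [znorm, EuclideanSpace.norm_eq]

lemma znorm_nonneg (k : Fin d → ℤ) : 0 ≤ znorm k := Real.sqrt_nonneg _

lemma znorm_zero : znorm (0 : Fin d → ℤ) = 0 := by simp [znorm]

lemma znorm_neg (k : Fin d → ℤ) : znorm (-k) = znorm k := by simp [znorm]

lemma znorm_add_le (k j : Fin d → ℤ) : znorm (k + j) ≤ znorm k + znorm j := by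
  have h : (WithLp.toLp 2 (fun i => (((k + j) i : ℤ) : ℝ)) : EuclideanSpace ℝ (Fin d)) =
      WithLp.toLp 2 (fun i => (k i : ℝ)) + WithLp.toLp 2 (fun i => (j i : ℝ)) := by
    ext i; simp
  rw [znorm_eq_norm, znorm_eq_norm, znorm_eq_norm, h]
  exact norm_add_le _ _

lemma znorm_le_add_sub (k j : Fin d → ℤ) : znorm k ≤ znorm j + znorm (k - j) := by
  simpa using znorm_add_le j (k - j)

lemma znorm_le_add_sub' (k j : Fin d → ℤ) : znorm j ≤ znorm k + znorm (k - j) := by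
  have h := znorm_le_add_sub j k
  rwa [← znorm_neg (j - k), neg_sub] at h

lemma znorm_pos {k : Fin d → ℤ} (hk : k ≠ 0) : 0 < znorm k := by
  refine Real.sqrt_pos.2 ?_
  obtain ⟨i, hi⟩ := Function.ne_iff.1 hk
  refine Finset.sum_pos' (fun _ _ => sq_nonneg _) ⟨i, Finset.mem_univ _, ?_⟩
  have : (k i : ℝ) ≠ 0 := by exact_mod_cast hi
  positivity

lemma finite_znorm_le (ρ : ℝ) : {k : Fin d → ℤ | znorm k ≤ ρ}.Finite := by
  refine (Set.finite_Icc (fun _ => -⌈ρ⌉) (fun _ => ⌈ρ⌉)).subset fun k hk => ?_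
  have h : ∀ i, |(k i : ℝ)| ≤ ρ := fun i => by
    refine le_trans ?_ (show znorm k ≤ ρ from hk)
    refine Real.abs_le_sqrt ?_
    exact Finset.single_le_sum (f := fun i => (k i : ℝ) ^ 2) (fun _ _ => sq_nonneg _)
      (Finset.mem_univ i)
  refine ⟨fun i => ?_, fun i => ?_⟩
  · have h1 := (abs_le.1 (h i)).1
    have h2 : (-⌈ρ⌉ : ℝ) ≤ k i := by linarith [Int.le_ceil ρ]
    exact_mod_cast h2
  · have h1 := (abs_le.1 (h i)).2
    have h2 : (k i : ℝ) ≤ ⌈ρ⌉ := by linarith [Int.le_ceil ρ]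
    exact_mod_cast h2

/-- Lattice points in the closed Euclidean ball of radius `ρ`. -/
def latBall (d : ℕ) (ρ : ℝ) : Finset (Fin d → ℤ) := (finite_znorm_le (d := d) ρ).toFinset

@[simp] lemma mem_latBall {ρ : ℝ} {k : Fin d → ℤ} : k ∈ latBall d ρ ↔ znorm k ≤ ρ := by
  simp [latBall]

lemma latBall_mono {ρ ρ' : ℝ} (h : ρ ≤ ρ') : latBall d ρ ⊆ latBall d ρ' := fun k hk => by
  rw [mem_latBall] at *; linarith

/-- Lattice points at distance at most `L` from the sphere of radius `ρ`. -/
def latShell (d : ℕ) (ρ L : ℝ) : Finset (Fin d → ℤ) :=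
  (latBall d (ρ + L)).filter fun k => ρ - L ≤ znorm k

lemma mem_latShell {ρ L : ℝ} {k : Fin d → ℤ} :
    k ∈ latShell d ρ L ↔ znorm k ∈ Set.Icc (ρ - L) (ρ + L) := by
  simp [latShell, and_comm]

lemma norm_zdot_le (k : Fin d → ℤ) (z : Fin d → ℂ) : ‖zdot k z‖ ≤ znorm k * cnorm z := by
  calc ‖zdot k z‖ ≤ ∑ i, |(k i : ℝ)| * ‖z i‖ := by
        refine (norm_sum_le _ _).trans (le_of_eq ?_)
        refine Finset.sum_congr rfl fun i _ => ?_
        rw [norm_mul]; simp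
    _ ≤ _ := by
        refine (Real.sum_mul_le_sqrt_mul_sqrt _ _ _).trans (le_of_eq ?_)
        simp [znorm, cnorm]

/-- Energy of the modes in the ball of radius `ρ`. -/
def ballMass (a : (Fin d → ℤ) → ℂ) (ρ : ℝ) : ℝ := ∑ k ∈ latBall d ρ, ‖a k‖ ^ 2

/-- Energy of the modes at distance at most `L` from the sphere of radius `ρ`. -/
def shellMass (a : (Fin d → ℤ) → ℂ) (ρ L : ℝ) : ℝ := ∑ k ∈ latShell d ρ L, ‖a k‖ ^ 2

lemma ballMass_mono (a : (Fin d → ℤ) → ℂ) {ρ ρ' : ℝ} (h : ρ ≤ ρ') :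
    ballMass a ρ ≤ ballMass a ρ' :=
  Finset.sum_le_sum_of_subset_of_nonneg (latBall_mono h) fun _ _ _ => sq_nonneg _

lemma shellMass_nonneg (a : (Fin d → ℤ) → ℂ) (ρ L : ℝ) : 0 ≤ shellMass a ρ L :=
  Finset.sum_nonneg fun _ _ => sq_nonneg _

/-- Rate of energy transfer from mode `j` to mode `k`. -/
def modeFlux (v : (Fin d → ℤ) → Fin d → ℂ) (a : (Fin d → ℤ) → ℂ) (k j : Fin d → ℤ) : ℝ :=
  2 * ((-(2 * (π : ℂ) * Complex.I * (zdot k (v (k - j)) * a j))) * starRingEnd ℂ (a k)).re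

lemma modeFlux_antisymm {v : (Fin d → ℤ) → Fin d → ℂ} (hdiv : DivFree v) (hreal : RealCoeff v)
    (a : (Fin d → ℤ) → ℂ) (k j : Fin d → ℤ) : modeFlux v a j k = -modeFlux v a k j := by
  have h1 : zdot j (v (j - k)) = starRingEnd ℂ (zdot k (v (k - j))) := by
    have h2 : zdot j (v (j - k)) = zdot k (v (j - k)) := by
      have h := hdiv (j - k)
      have h3 : zdot (j - k) (v (j - k)) = zdot j (v (j - k)) - zdot k (v (j - k)) := by
        simp [zdot, sub_mul, Finset.sum_sub_distrib]
      rw [h3] at h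
      exact sub_eq_zero.1 h
    have h4 : ∀ i, v (j - k) i = starRingEnd ℂ (v (k - j) i) := fun i => by
      rw [← hreal, neg_sub]
    rw [h2]
    simp [zdot, h4, map_sum]
  unfold modeFlux
  rw [h1]
  have h5 : -(2 * (π : ℂ) * Complex.I * (starRingEnd ℂ (zdot k (v (k - j))) * a k)) *
      starRingEnd ℂ (a j) = -(starRingEnd ℂ
        (-(2 * (π : ℂ) * Complex.I * (zdot k (v (k - j)) * a j)) * starRingEnd ℂ (a k))) := by
    simp only [map_mul, map_neg, Complex.conj_I, Complex.conj_conj, Complex.conj_ofReal,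
      Complex.conj_ofNat]
    ring
  rw [h5, Complex.neg_re, Complex.conj_re]
  ring

lemma abs_modeFlux_le {v : (Fin d → ℤ) → Fin d → ℂ} {x L : ℝ}
    (hv : ∀ k, cnorm (v k) ≤ if znorm k ≤ L then x else 0)
    (a : (Fin d → ℤ) → ℂ) (k j : Fin d → ℤ) :
    |modeFlux v a k j| ≤ if znorm (k - j) ≤ L then
      2 * π * znorm k * x * (‖a k‖ ^ 2 + ‖a j‖ ^ 2) else 0 := by
  have h1 : |modeFlux v a k j| ≤
      4 * π * (znorm k * cnorm (v (k - j))) * (‖a k‖ * ‖a j‖) := by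
    unfold modeFlux
    rw [abs_mul, abs_two]
    refine (mul_le_mul_of_nonneg_left (Complex.abs_re_le_norm _) zero_le_two).trans ?_
    simp only [norm_mul, norm_neg, Complex.norm_ofNat, Complex.norm_real, Complex.norm_I,
      RCLike.norm_conj, mul_one, Real.norm_eq_abs, abs_of_pos Real.pi_pos]
    have := mul_le_mul_of_nonneg_left (norm_zdot_le k (v (k - j)))
      (show 0 ≤ 4 * π * (‖a k‖ * ‖a j‖) by positivity)
    linarith
  have h2 := hv (k - j)
  have hk := znorm_nonneg k
  have hc : 0 ≤ cnorm (v (k - j)) := Real.sqrt_nonneg _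
  split_ifs at h2 ⊢ with h
  · have h3 : znorm k * cnorm (v (k - j)) ≤ znorm k * x := mul_le_mul_of_nonneg_left h2 hk
    have h4 : ‖a k‖ * ‖a j‖ ≤ (‖a k‖ ^ 2 + ‖a j‖ ^ 2) / 2 := by
      nlinarith [sq_nonneg (‖a k‖ - ‖a j‖)]
    have hx : 0 ≤ x := hc.trans h2
    calc _ ≤ _ := h1
      _ ≤ 4 * π * (znorm k * x) * ((‖a k‖ ^ 2 + ‖a j‖ ^ 2) / 2) := by gcongr
      _ = _ := by ring
  · have h3 : cnorm (v (k - j)) = 0 := le_antisymm h2 hc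
    simpa [h3] using h1

lemma card_filter_sub_le (S : Finset (Fin d → ℤ)) (k : Fin d → ℤ) (L : ℝ) :
    (S.filter fun j => znorm (k - j) ≤ L).card ≤ (latBall d L).card := by
  refine Finset.card_le_card_of_injOn (fun j => k - j) (fun j hj => ?_) ?_
  · simp only [Finset.coe_filter, Set.mem_ofPred_eq] at hj
    simpa using hj.2
  · intro j _ j' _ h
    simpa using h

lemma sum_near_pairs_le (S : Finset (Fin d → ℤ)) (L : ℝ) (b : (Fin d → ℤ) → ℝ)
    (hb : ∀ k, 0 ≤ b k) :
    ∑ k ∈ S, ∑ j ∈ S, (if znorm (k - j) ≤ L then b k else 0) ≤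
      (latBall d L).card * ∑ k ∈ S, b k := by
  rw [Finset.mul_sum]
  refine Finset.sum_le_sum fun k _ => ?_
  rw [← Finset.sum_filter, Finset.sum_const, nsmul_eq_mul]
  exact mul_le_mul_of_nonneg_right (by exact_mod_cast card_filter_sub_le S k L) (hb k)

/-- Constant in the flux bound: energy is carried through the sphere of radius `ρ` at rate at
most `fluxConst d L * ρ * x` times the energy near that sphere. -/
def fluxConst (d : ℕ) (L : ℝ) : ℝ := 4 * π * (latBall d L).card

lemma fluxConst_nonneg (d : ℕ) (L : ℝ) : 0 ≤ fluxConst d L := by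
  unfold fluxConst; positivity

lemma one_le_fluxConst (d : ℕ) {L : ℝ} (hL : 0 ≤ L) : 1 ≤ fluxConst d L := by
  have h : 1 ≤ (latBall d L).card :=
    Finset.card_pos.2 ⟨0, by simpa [znorm_zero] using hL⟩
  have h' : (1 : ℝ) ≤ (latBall d L).card := by exact_mod_cast h
  unfold fluxConst
  nlinarith [Real.pi_gt_three]

lemma abs_sum_modeFlux_le {v : (Fin d → ℤ) → Fin d → ℂ} (hdiv : DivFree v) (hreal : RealCoeff v)
    {x L ρ : ℝ} (hx : 0 ≤ x) (hL : 0 ≤ L) (hρ : 0 ≤ ρ)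
    (hv : ∀ k, cnorm (v k) ≤ if znorm k ≤ L then x else 0) (a : (Fin d → ℤ) → ℂ) :
    |∑ k ∈ latBall d ρ, ∑ j ∈ latBall d (ρ + L), modeFlux v a k j| ≤
      fluxConst d L * ρ * x * shellMass a ρ L := by
  have hsub : latBall d ρ ⊆ latBall d (ρ + L) := latBall_mono (by linarith)
  have hin : ∑ k ∈ latBall d ρ, ∑ j ∈ latBall d ρ, modeFlux v a k j = 0 := by
    have h : ∑ k ∈ latBall d ρ, ∑ j ∈ latBall d ρ, modeFlux v a k j =
        -∑ k ∈ latBall d ρ, ∑ j ∈ latBall d ρ, modeFlux v a k j := by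
      conv_lhs => rw [Finset.sum_comm]
      simp_rw [← Finset.sum_neg_distrib, ← modeFlux_antisymm hdiv hreal a]
    linarith
  have hsplit : ∑ k ∈ latBall d ρ, ∑ j ∈ latBall d (ρ + L), modeFlux v a k j =
      ∑ k ∈ latBall d ρ, ∑ j ∈ latBall d (ρ + L) \ latBall d ρ, modeFlux v a k j := by
    simp_rw [← Finset.sum_sdiff hsub, Finset.sum_add_distrib, hin, add_zero]
  set c := 2 * π * ρ * x with hc
  have hc0 : 0 ≤ c := by positivity
  let F : (Fin d → ℤ) → (Fin d → ℤ) → ℝ := fun k j =>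
    if znorm (k - j) ≤ L then c * (‖a k‖ ^ 2 + ‖a j‖ ^ 2) else 0
  have hF0 : ∀ k j, 0 ≤ F k j := fun k j => by
    simp only [F]; split_ifs <;> positivity
  have hterm : ∀ k ∈ latBall d ρ, ∀ j, |modeFlux v a k j| ≤ F k j := fun k hk j => by
    refine (abs_modeFlux_le hv a k j).trans ?_
    simp only [F]
    rw [mem_latBall] at hk
    split_ifs
    · rw [hc]; gcongr
    · exact le_rfl
  have hshell : ∀ k ∈ latBall d ρ, ∀ j ∈ latBall d (ρ + L) \ latBall d ρ,
      ¬(k ∈ latShell d ρ L ∧ j ∈ latShell d ρ L) → F k j = 0 := fun k hk j hj hn => by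
    simp only [F]
    rw [if_neg]
    intro h
    apply hn
    simp only [Finset.mem_sdiff, mem_latBall, not_le] at hk hj
    simp only [mem_latShell, Set.mem_Icc]
    have h1 := znorm_le_add_sub k j
    have h2 := znorm_le_add_sub' k j
    refine ⟨⟨?_, ?_⟩, ?_, ?_⟩ <;> linarith
  rw [hsplit]
  calc _ ≤ ∑ k ∈ latBall d ρ, ∑ j ∈ latBall d (ρ + L) \ latBall d ρ, F k j := by
        refine (Finset.abs_sum_le_sum_abs _ _).trans (Finset.sum_le_sum fun k hk => ?_)
        exact (Finset.abs_sum_le_sum_abs _ _).trans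
          (Finset.sum_le_sum fun j _ => hterm k hk j)
    _ ≤ ∑ k ∈ latShell d ρ L, ∑ j ∈ latShell d ρ L, F k j := by
        rw [← Finset.sum_product', ← Finset.sum_product']
        rw [← Finset.sum_filter_of_ne (p := fun q => q ∈ latShell d ρ L ×ˢ latShell d ρ L)
          fun q hq hne => ?_]
        · exact Finset.sum_le_sum_of_subset_of_nonneg
            (fun q hq => (Finset.mem_filter.1 hq).2) fun q _ _ => hF0 _ _
        · rw [Finset.mem_product] at hq ⊢
          by_contra hn
          exact hne (hshell q.1 hq.1 q.2 hq.2 hn)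
    _ = (∑ k ∈ latShell d ρ L, ∑ j ∈ latShell d ρ L,
          (if znorm (k - j) ≤ L then c * ‖a k‖ ^ 2 else 0)) +
        ∑ k ∈ latShell d ρ L, ∑ j ∈ latShell d ρ L,
          (if znorm (j - k) ≤ L then c * ‖a k‖ ^ 2 else 0) := by
        conv_rhs => rw [add_comm, Finset.sum_comm, add_comm]
        simp_rw [← Finset.sum_add_distrib]
        refine Finset.sum_congr rfl fun k _ => Finset.sum_congr rfl fun j _ => ?_
        simp only [F]
        split_ifs <;> ring
    _ = 2 * ∑ k ∈ latShell d ρ L, ∑ j ∈ latShell d ρ L,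
          (if znorm (k - j) ≤ L then c * ‖a k‖ ^ 2 else 0) := by
        simp_rw [fun j k : Fin d → ℤ => show znorm (j - k) = znorm (k - j) by
          rw [← znorm_neg, neg_sub]]
        ring
    _ ≤ 2 * ((latBall d L).card * ∑ k ∈ latShell d ρ L, c * ‖a k‖ ^ 2) := by
        refine mul_le_mul_of_nonneg_left (sum_near_pairs_le _ L _ fun k => ?_) zero_le_two
        positivity
    _ = _ := by
        rw [← Finset.mul_sum, hc, fluxConst, shellMass]
        ring

lemma two_inner_fourierRHS {v : (Fin d → ℤ) → Fin d → ℂ} {x L ρ ν : ℝ}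
    (hv : ∀ k, cnorm (v k) ≤ if znorm k ≤ L then x else 0) (a : (Fin d → ℤ) → ℂ)
    {k : Fin d → ℤ} (hk : k ∈ latBall d ρ) :
    2 * inner ℝ (a k) (fourierRHS ν v a k) =
      -(8 * π ^ 2 * ν * znorm k ^ 2 * ‖a k‖ ^ 2) + ∑ j ∈ latBall d (ρ + L), modeFlux v a k j := by
  have hts : ∑' j, zdot k (v (k - j)) * a j =
      ∑ j ∈ latBall d (ρ + L), zdot k (v (k - j)) * a j := by
    refine tsum_eq_sum fun j hj => ?_
    rw [mem_latBall] at hk hj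
    have h1 : ¬ znorm (k - j) ≤ L := fun h => hj (by linarith [znorm_le_add_sub' k j])
    have h2 := hv (k - j)
    rw [if_neg h1] at h2
    have h3 : ‖zdot k (v (k - j))‖ ≤ 0 :=
      (norm_zdot_le _ _).trans (mul_nonpos_of_nonneg_of_nonpos (znorm_nonneg k) h2)
    rw [norm_le_zero_iff.1 h3, zero_mul]
  rw [Complex.inner, fourierRHS, hts, Finset.mul_sum, sub_mul, Complex.sub_re, Finset.sum_mul,
    Complex.re_sum]
  simp only [modeFlux, neg_mul, Complex.neg_re]
  rw [mul_assoc (Complex.ofReal _), Complex.mul_conj, ← Complex.ofReal_mul, Complex.ofReal_re,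
    Complex.normSq_eq_norm_sq, mul_sub, Finset.mul_sum, sub_eq_add_neg, ← Finset.sum_neg_distrib]
  congr 1
  · ring
  · exact Finset.sum_congr rfl fun j _ => by ring

/-- Energy balance in a ball: dissipation plus a boundary flux. -/
lemma abs_energy_rate_add_dissipation_le {v : (Fin d → ℤ) → Fin d → ℂ} (hdiv : DivFree v)
    (hreal : RealCoeff v) {x L ρ : ℝ} (ν : ℝ) (hx : 0 ≤ x) (hL : 0 ≤ L) (hρ : 0 ≤ ρ)
    (hv : ∀ k, cnorm (v k) ≤ if znorm k ≤ L then x else 0) (a : (Fin d → ℤ) → ℂ) :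
    |∑ k ∈ latBall d ρ, 2 * inner ℝ (a k) (fourierRHS ν v a k) +
      ∑ k ∈ latBall d ρ, 8 * π ^ 2 * ν * znorm k ^ 2 * ‖a k‖ ^ 2| ≤
      fluxConst d L * ρ * x * shellMass a ρ L := by
  refine le_trans (le_of_eq ?_) (abs_sum_modeFlux_le hdiv hreal hx hL hρ hv a)
  rw [← Finset.sum_add_distrib]
  congr 1
  refine Finset.sum_congr rfl fun k hk => ?_
  rw [two_inner_fourierRHS hv a hk]
  ring

end Lattice

section Path

variable {d : ℕ}

lemma coe_nnnorm_sq (z : ℂ) : (‖z‖₊ : ℝ≥0∞) ^ 2 = ENNReal.ofReal (‖z‖ ^ 2) := by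
  rw [ENNReal.ofReal_pow (norm_nonneg _), ← enorm_eq_nnnorm, ofReal_norm]

lemma massOn_eq_ofReal_sum (a : (Fin d → ℤ) → ℂ) {E : Set ℝ} {S : Finset (Fin d → ℤ)}
    (hS : ∀ k, k ∈ S ↔ znorm k ∈ E) :
    massOn a E = ENNReal.ofReal (∑ k ∈ S, ‖a k‖ ^ 2) := by
  rw [massOn, tsum_eq_sum (s := S) fun k hk => if_neg (mt (hS k).2 hk),
    ENNReal.ofReal_sum_of_nonneg fun _ _ => sq_nonneg _]
  exact Finset.sum_congr rfl fun k hk => by rw [if_pos ((hS k).1 hk), coe_nnnorm_sq]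

lemma massOn_mono (a : (Fin d → ℤ) → ℂ) {E F : Set ℝ} (h : E ⊆ F) : massOn a E ≤ massOn a F := by
  refine ENNReal.tsum_le_tsum fun k => ?_
  by_cases hk : znorm k ∈ E
  · rw [if_pos hk, if_pos (h hk)]
  · rw [if_neg hk]; exact zero_le

lemma massOn_Icc_eq_shellMass (a : (Fin d → ℤ) → ℂ) (ρ L : ℝ) :
    massOn a (Set.Icc (ρ - L) (ρ + L)) = ENNReal.ofReal (shellMass a ρ L) :=
  massOn_eq_ofReal_sum a fun _ => mem_latShell

lemma massOn_Iic_eq_ballMass (a : (Fin d → ℤ) → ℂ) (ρ : ℝ) :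
    massOn a (Set.Iic ρ) = ENNReal.ofReal (ballMass a ρ) :=
  massOn_eq_ofReal_sum a fun _ => by simp

/-- A single realisation of the Fourier advection–diffusion system whose velocity is supported in
the ball of radius `L` and has size at most `x t` at time `t`. -/
structure ControlledPath (ν L : ℝ) (g : (Fin d → ℤ) → ℂ) (u : ℝ → (Fin d → ℤ) → Fin d → ℂ)
    (b : ℝ → (Fin d → ℤ) → ℂ) (x : ℝ → ℝ) : Prop where
  divFree : ∀ t, 0 ≤ t → DivFree (u t)
  realCoeff : ∀ t, 0 ≤ t → RealCoeff (u t)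
  init : b 0 = g
  deriv : ∀ k, ∀ t ∈ Set.Ici (0 : ℝ),
    HasDerivWithinAt (fun s => b s k) (fourierRHS ν (u t) (b t) k) (Set.Ici 0) t
  decay : ∀ N : ℕ, ∀ T > (0 : ℝ), ∃ M : ℝ, ∀ t ∈ Set.Icc (0 : ℝ) T,
    ∑' k : Fin d → ℤ, ENNReal.ofReal ((1 + znorm k) ^ N) * (‖b t k‖₊ : ℝ≥0∞) ^ 2
      ≤ ENNReal.ofReal M
  init_zero : g 0 = 0
  init_mass : (∑' k : Fin d → ℤ, (‖g k‖₊ : ℝ≥0∞) ^ 2) = 1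
  one_le : ∀ t, 1 ≤ x t
  bound : ∀ t, 0 ≤ t → ∀ k, cnorm (u t k) ≤ if znorm k ≤ L then x t else 0
  integrable : ∀ T > (0 : ℝ), IntegrableOn x (Set.Icc 0 T)

namespace ControlledPath

variable {ν L : ℝ} {g : (Fin d → ℤ) → ℂ} {u : ℝ → (Fin d → ℤ) → Fin d → ℂ}
  {b : ℝ → (Fin d → ℤ) → ℂ} {x : ℝ → ℝ}

lemma continuousOn (h : ControlledPath ν L g u b x) (k : Fin d → ℤ) :
    ContinuousOn (fun t => b t k) (Set.Ici 0) :=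
  fun t ht => (h.deriv k t ht).continuousWithinAt

lemma continuousOn_sum (h : ControlledPath ν L g u b x) (S : Finset (Fin d → ℤ)) (T : ℝ) :
    ContinuousOn (fun t => ∑ k ∈ S, ‖b t k‖ ^ 2) (Set.Icc 0 T) := by
  refine continuousOn_finsetSum _ fun k _ => ?_
  exact (((h.continuousOn k).mono Set.Icc_subset_Ici_self).norm).pow 2

lemma zero_mode (h : ControlledPath ν L g u b x) {t : ℝ} (ht : 0 ≤ t) : b t 0 = 0 := by
  have hc := constant_of_has_deriv_right_zero (f := fun s => b s 0) (a := 0) (b := t)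
    ((h.continuousOn 0).mono Set.Icc_subset_Ici_self) fun s hs => by
      have h1 := (h.deriv 0 s hs.1).mono (Set.Ici_subset_Ici.2 hs.1)
      convert h1 using 1
      simp [fourierRHS, znorm_zero, zdot]
  rw [hc t ⟨ht, le_rfl⟩, h.init, h.init_zero]

lemma hasDerivWithinAt_ballMass (h : ControlledPath ν L g u b x) (ρ : ℝ) {t : ℝ} (ht : 0 ≤ t) :
    HasDerivWithinAt (fun s => ballMass (b s) ρ)
      (∑ k ∈ latBall d ρ, 2 * inner ℝ (b t k) (fourierRHS ν (u t) (b t) k)) (Set.Ioi t) t := by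
  refine HasDerivWithinAt.fun_sum fun k _ => ?_
  exact ((h.deriv k t ht).mono (Set.Ioi_subset_Ici ht)).norm_sq

lemma ballMass_sub_le (h : ControlledPath ν L g u b x) (hν : 0 ≤ ν) (hL : 0 ≤ L) {ρ T : ℝ}
    (hρ : 0 ≤ ρ) (hT : 0 ≤ T) {φ : ℝ → ℝ} (hφ : IntegrableOn φ (Set.Icc 0 T))
    (hle : ∀ t ∈ Set.Ioo 0 T, fluxConst d L * ρ * x t * shellMass (b t) ρ L ≤ φ t) :
    ballMass (b T) ρ - ballMass (b 0) ρ ≤ ∫ t in (0 : ℝ)..T, φ t := by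
  refine intervalIntegral.sub_le_integral_of_hasDeriv_right_of_le hT
    (h.continuousOn_sum _ T) (fun t ht => h.hasDerivWithinAt_ballMass ρ ht.1.le) hφ fun t ht => ?_
  have h1 := abs_le.1 (abs_energy_rate_add_dissipation_le (h.divFree t ht.1.le)
    (h.realCoeff t ht.1.le) ν (zero_le_one.trans (h.one_le t)) hL hρ (h.bound t ht.1.le) (b t))
  have h2 : 0 ≤ ∑ k ∈ latBall d ρ, 8 * π ^ 2 * ν * znorm k ^ 2 * ‖b t k‖ ^ 2 :=
    Finset.sum_nonneg fun _ _ => by positivity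
  linarith [hle t ht, h1.2]

lemma sub_ballMass_le (h : ControlledPath ν L g u b x) (hν : 0 ≤ ν) (hL : 0 ≤ L) {ρ T : ℝ}
    (hρ : 0 ≤ ρ) (hT : 0 ≤ T) {φ : ℝ → ℝ} (hφ : IntegrableOn φ (Set.Icc 0 T))
    (hle : ∀ t ∈ Set.Ioo 0 T, 8 * π ^ 2 * ν * ρ ^ 2 * ballMass (b t) ρ +
      fluxConst d L * ρ * x t * shellMass (b t) ρ L ≤ φ t) :
    ballMass (b 0) ρ - ballMass (b T) ρ ≤ ∫ t in (0 : ℝ)..T, φ t := by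
  have key := intervalIntegral.sub_le_integral_of_hasDeriv_right_of_le
    (g := fun s => -ballMass (b s) ρ) hT
    (h.continuousOn_sum _ T).neg (fun t ht => (h.hasDerivWithinAt_ballMass ρ ht.1.le).fun_neg)
    hφ fun t ht => by
      have h1 := abs_le.1 (abs_energy_rate_add_dissipation_le (h.divFree t ht.1.le)
        (h.realCoeff t ht.1.le) ν (zero_le_one.trans (h.one_le t)) hL hρ (h.bound t ht.1.le) (b t))
      have h2 : ∑ k ∈ latBall d ρ, 8 * π ^ 2 * ν * znorm k ^ 2 * ‖b t k‖ ^ 2 ≤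
          8 * π ^ 2 * ν * ρ ^ 2 * ballMass (b t) ρ := by
        rw [ballMass, Finset.mul_sum]
        refine Finset.sum_le_sum fun k hk => ?_
        have := mem_latBall.1 hk
        have := znorm_nonneg k
        gcongr
      linarith [hle t ht, h1.1]
  linarith

lemma ballMass_init_le_one (h : ControlledPath ν L g u b x) (ρ : ℝ) : ballMass (b 0) ρ ≤ 1 := by
  rw [← ENNReal.ofReal_le_one, ← massOn_Iic_eq_ballMass, h.init, ← h.init_mass]
  refine ENNReal.tsum_le_tsum fun k => ?_
  split_ifs
  · exact le_rfl
  · exact zero_le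

lemma exists_shellMass_le (h : ControlledPath ν L g u b x) {T : ℝ} (hT : 0 < T) :
    ∃ M : ℝ, 0 ≤ M ∧ ∀ t ∈ Set.Icc 0 T, ∀ ρ, 2 * L ≤ ρ → 0 ≤ ρ →
      ρ ^ 2 * shellMass (b t) ρ L ≤ M := by
  obtain ⟨M, hM⟩ := h.decay 2 T hT
  refine ⟨4 * max M 0, by positivity, fun t ht ρ hρ hρ0 => ?_⟩
  have h1 : ∑ k ∈ latShell d ρ L, (1 + znorm k) ^ 2 * ‖b t k‖ ^ 2 ≤ max M 0 := by
    rw [← ENNReal.ofReal_le_ofReal_iff (le_max_right _ _),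
      ENNReal.ofReal_sum_of_nonneg fun _ _ => by positivity]
    refine le_trans ?_ ((hM t ht).trans (ENNReal.ofReal_le_ofReal (le_max_left _ _)))
    refine le_trans (le_of_eq ?_) (ENNReal.sum_le_tsum (latShell d ρ L))
    exact Finset.sum_congr rfl fun k _ => by
      rw [ENNReal.ofReal_mul (by positivity), coe_nnnorm_sq]
  have h2 : (ρ / 2) ^ 2 * shellMass (b t) ρ L ≤
      ∑ k ∈ latShell d ρ L, (1 + znorm k) ^ 2 * ‖b t k‖ ^ 2 := by
    rw [shellMass, Finset.mul_sum]
    refine Finset.sum_le_sum fun k hk => ?_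
    have := (mem_latShell.1 hk).1
    have h3 : ρ / 2 ≤ 1 + znorm k := by linarith
    gcongr
  linarith

lemma ballMass_le_one (h : ControlledPath ν L g u b x) (hν : 0 ≤ ν) (hL : 0 ≤ L) (r : ℝ) {t : ℝ}
    (ht : 0 ≤ t) : ballMass (b t) r ≤ 1 := by
  rcases ht.eq_or_lt with rfl | ht'
  · exact h.ballMass_init_le_one r
  obtain ⟨M, hM0, hM⟩ := h.exists_shellMass_le ht'
  set I := ∫ s in (0 : ℝ)..t, x s
  set c := fluxConst d L * M * I with hc
  have hbd : ∀ ρ, 2 * L ≤ ρ → 0 < ρ → ballMass (b t) ρ ≤ 1 + c / ρ := fun ρ h2 hρ => by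
    have h3 := h.ballMass_sub_le hν hL hρ.le ht
      (φ := fun s => fluxConst d L * M / ρ * x s) ((h.integrable t ht').const_mul _)
      fun s hs => by
        have h4 := hM s ⟨hs.1.le, hs.2.le⟩ ρ h2 hρ.le
        have hx := zero_le_one.trans (h.one_le s)
        have hA := fluxConst_nonneg d L
        have h5 : ρ * shellMass (b s) ρ L ≤ M / ρ := by
          rw [le_div_iff₀ hρ]; linarith
        calc _ = fluxConst d L * x s * (ρ * shellMass (b s) ρ L) := by ring
          _ ≤ fluxConst d L * x s * (M / ρ) := by gcongr
          _ = _ := by ring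
    rw [intervalIntegral.integral_const_mul] at h3
    have h6 : fluxConst d L * M / ρ * I = c / ρ := by rw [hc]; ring
    rw [h6] at h3
    linarith [h.ballMass_init_le_one ρ]
  refine le_of_forall_pos_le_add fun ε hε => ?_
  set ρ := max (max (2 * L) r) (max 1 (c / ε)) with hρdef
  have h1 : 2 * L ≤ ρ := (le_max_left _ _).trans (le_max_left _ _)
  have h2 : r ≤ ρ := (le_max_right _ _).trans (le_max_left _ _)
  have h3 : 1 ≤ ρ := (le_max_left _ _).trans (le_max_right _ _)
  have h4 : c / ε ≤ ρ := (le_max_right _ _).trans (le_max_right _ _)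
  have hρ : 0 < ρ := by linarith
  have h5 : c / ρ ≤ ε := by
    rw [div_le_iff₀ hρ]; rw [div_le_iff₀ hε] at h4; linarith
  linarith [hbd ρ h1 hρ, ballMass_mono (b t) h2]

/-- Energy leaves a ball only by dissipation or by the flux through the boundary sphere. -/
lemma ballMass_init_le (h : ControlledPath ν L g u b x) (hν : 0 ≤ ν) (hL : 0 ≤ L) {ρ T : ℝ}
    (hρ : 0 ≤ ρ) (hT : 0 < T) :
    ENNReal.ofReal (ballMass g ρ) ≤ ENNReal.ofReal (ballMass (b T) ρ) +
      ENNReal.ofReal (8 * π ^ 2 * ν * ρ ^ 2 * T) +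
      ENNReal.ofReal (fluxConst d L * ρ) * ∫⁻ t in Set.Icc 0 T,
        ENNReal.ofReal (x t) * massOn (b t) (Set.Icc (ρ - L) (ρ + L)) := by
  set D := 8 * π ^ 2 * ν * ρ ^ 2 with hD
  have hD0 : 0 ≤ D := by positivity
  have hA := fluxConst_nonneg d L
  have hint : IntegrableOn (fun t => x t * shellMass (b t) ρ L) (Set.Icc 0 T) :=
    (h.integrable T hT).mul_continuousOn (h.continuousOn_sum _ T) isCompact_Icc
  have hsub := h.sub_ballMass_le hν hL hρ hT.le
    (φ := fun t => D + fluxConst d L * ρ * (x t * shellMass (b t) ρ L))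
    ((integrableOn_const (by simp)).add (hint.const_mul _)) fun t ht => by
      have h1 : D * ballMass (b t) ρ ≤ D * 1 :=
        mul_le_mul_of_nonneg_left (h.ballMass_le_one hν hL ρ ht.1.le) hD0
      linarith
  have hint' : IntervalIntegrable (fun t => x t * shellMass (b t) ρ L) volume 0 T :=
    (intervalIntegrable_iff_integrableOn_Icc_of_le hT.le).2 hint
  rw [intervalIntegral.integral_add (by simp) (hint'.const_mul _),
    intervalIntegral.integral_const_mul (fluxConst d L * ρ), intervalIntegral.integral_const,
    intervalIntegral.integral_of_le hT.le, ← integral_Icc_eq_integral_Ioc, h.init] at hsub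
  have hnn : ∀ t, 0 ≤ x t * shellMass (b t) ρ L := fun t =>
    mul_nonneg (zero_le_one.trans (h.one_le t)) (shellMass_nonneg _ _ _)
  have hlin : ENNReal.ofReal (∫ t in Set.Icc 0 T, x t * shellMass (b t) ρ L) =
      ∫⁻ t in Set.Icc 0 T, ENNReal.ofReal (x t) * massOn (b t) (Set.Icc (ρ - L) (ρ + L)) := by
    rw [ofReal_integral_eq_lintegral_ofReal hint (Filter.Eventually.of_forall hnn)]
    refine lintegral_congr fun t => ?_
    rw [massOn_Icc_eq_shellMass, ENNReal.ofReal_mul (zero_le_one.trans (h.one_le t))]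
  have hI : 0 ≤ ∫ t in Set.Icc 0 T, x t * shellMass (b t) ρ L := integral_nonneg hnn
  have hb : 0 ≤ ballMass (b T) ρ := Finset.sum_nonneg fun _ _ => sq_nonneg _
  rw [← hlin, ← ENNReal.ofReal_mul (by positivity), ← ENNReal.ofReal_add hb (by positivity),
    ← ENNReal.ofReal_add (by positivity) (by positivity)]
  refine ENNReal.ofReal_le_ofReal ?_
  simp only [sub_zero, smul_eq_mul] at hsub
  linarith

lemma massOn_le_one (h : ControlledPath ν L g u b x) (hν : 0 ≤ ν) (hL : 0 ≤ L) {t : ℝ}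
    (ht : 0 ≤ t) (r s : ℝ) : massOn (b t) (Set.Icc r s) ≤ 1 := by
  refine (massOn_mono _ Set.Icc_subset_Iic_self).trans ?_
  rw [massOn_Iic_eq_ballMass, ENNReal.ofReal_le_one]
  exact h.ballMass_le_one hν hL s ht

/-- The energy in a ball is controlled by the negative Sobolev norm. -/
lemma ballMass_le_mul_tsum (h : ControlledPath ν L g u b x) {ρ t : ℝ} (ht : 0 ≤ t) :
    ENNReal.ofReal (ballMass (b t) ρ) ≤ ENNReal.ofReal ((2 * π * ρ) ^ 2) *
      ∑' k : Fin d → ℤ, if k = 0 then 0 else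
        (ENNReal.ofReal ((2 * π * znorm k) ^ 2))⁻¹ * (‖b t k‖₊ : ℝ≥0∞) ^ 2 := by
  rw [← massOn_Iic_eq_ballMass, massOn, ← ENNReal.tsum_mul_left]
  refine ENNReal.tsum_le_tsum fun k => ?_
  by_cases hk : k = 0
  · simp [hk, h.zero_mode ht]
  rw [if_neg hk]
  split_ifs with hkρ
  · have hz := znorm_pos hk
    rw [← mul_assoc, ← ENNReal.div_eq_inv_mul.trans (mul_comm _ _)]
    refine le_mul_of_one_le_left zero_le ?_
    rw [ENNReal.le_div_iff_mul_le (by left; simp; positivity) (by simp), one_mul]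
    refine ENNReal.ofReal_le_ofReal ?_
    have : znorm k ≤ ρ := hkρ
    gcongr
  · exact zero_le

end ControlledPath

end Path

section Expectation

variable {d : ℕ}

lemma ofReal_le_add_rpow {x lam p : ℝ} (hx : 1 ≤ x) (hlam : 0 < lam) (hp : 1 ≤ p) :
    ENNReal.ofReal x ≤
      ENNReal.ofReal lam + ENNReal.ofReal (lam ^ (1 - p)) * ENNReal.ofReal (x ^ p) := by
  have hx0 : 0 < x := by linarith
  rcases le_total x lam with h | h
  · exact (ENNReal.ofReal_le_ofReal h).trans le_self_add
  · refine le_trans (ENNReal.ofReal_le_ofReal ?_)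
      ((ENNReal.ofReal_mul (by positivity)).le.trans le_add_self)
    calc x = x ^ (1 - p) * x ^ p := by
          rw [← Real.rpow_add hx0]; simp
      _ ≤ _ := mul_le_mul_of_nonneg_right
          (Real.rpow_le_rpow_of_nonpos hlam h (by linarith)) (by positivity)

lemma massOn_eq_tsum_indicator (b : (Fin d → ℤ) → ℂ) (E : Set ℝ) :
    massOn b E = ∑' k : Fin d → ℤ, E.indicator (fun _ => (‖b k‖₊ : ℝ≥0∞) ^ 2) (znorm k) :=
  tsum_congr fun k => by
    by_cases hk : znorm k ∈ E
    · rw [if_pos hk, Set.indicator_of_mem hk]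
    · rw [if_neg hk, Set.indicator_of_notMem hk]

/-- Integrating the mass of a sliding window of width `w` over its left endpoint. -/
lemma lintegral_massOn_window_le (b : (Fin d → ℤ) → ℂ) {w : ℝ}
    (hb : ∀ r s, massOn b (Set.Icc r s) ≤ 1) (A B : ℝ) :
    ∫⁻ r in Set.Icc A B, massOn b (Set.Icc r (r + w)) ≤ ENNReal.ofReal (min (B - A) w) := by
  rcases le_total (B - A) w with h | h
  · rw [min_eq_left h]
    calc _ ≤ ∫⁻ _ in Set.Icc A B, 1 := lintegral_mono fun r => hb _ _
      _ = _ := by simp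
  · rw [min_eq_right h]
    have hmeas : ∀ k : Fin d → ℤ, Measurable fun r : ℝ =>
        (Set.Icc r (r + w)).indicator (fun _ => (‖b k‖₊ : ℝ≥0∞) ^ 2) (znorm k) := fun k => by
      simp only [Set.indicator_apply]
      refine Measurable.ite ?_ measurable_const measurable_const
      exact (measurableSet_le measurable_id measurable_const).inter
        (measurableSet_le measurable_const (measurable_id.add_const w))
    have hk : ∀ k : Fin d → ℤ, ∫⁻ r in Set.Icc A B,
        (Set.Icc r (r + w)).indicator (fun _ => (‖b k‖₊ : ℝ≥0∞) ^ 2) (znorm k) ≤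
        ENNReal.ofReal w *
          (Set.Icc A (B + w)).indicator (fun _ => (‖b k‖₊ : ℝ≥0∞) ^ 2) (znorm k) := fun k => by
      rw [Set.indicator_apply (Set.Icc A (B + w))]
      split_ifs with hin
      · calc _ ≤ ∫⁻ r, (Set.Icc (znorm k - w) (znorm k)).indicator
                (fun _ => (‖b k‖₊ : ℝ≥0∞) ^ 2) r := by
              refine (setLIntegral_le_lintegral _ _).trans (lintegral_mono fun r => ?_)
              rw [Set.indicator_apply, Set.indicator_apply]
              split_ifs with h1 h2
              · exact le_rfl
              · exact absurd ⟨by linarith [h1.2], h1.1⟩ h2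
              · exact zero_le
              · exact le_rfl
          _ = _ := by
              rw [lintegral_indicator measurableSet_Icc]
              simp [mul_comm]
      · rw [mul_zero, nonpos_iff_eq_zero]
        refine (setLIntegral_congr_fun (g := 0) measurableSet_Icc fun r hr => ?_).trans (by simp)
        exact Set.indicator_of_notMem (fun h1 => hin
          ⟨hr.1.trans h1.1, h1.2.trans (by linarith [hr.2])⟩) _
    calc _ = ∑' k : Fin d → ℤ, ∫⁻ r in Set.Icc A B,
          (Set.Icc r (r + w)).indicator (fun _ => (‖b k‖₊ : ℝ≥0∞) ^ 2) (znorm k) := by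
          simp_rw [massOn_eq_tsum_indicator]
          exact lintegral_tsum fun k => (hmeas k).aemeasurable
      _ ≤ ENNReal.ofReal w * massOn b (Set.Icc A (B + w)) := by
          rw [massOn_eq_tsum_indicator, ← ENNReal.tsum_mul_left]
          exact ENNReal.tsum_le_tsum hk
      _ ≤ _ := mul_le_of_le_one_right zero_le (hb _ _)

variable {Ω : Type*} [MeasurableSpace Ω]

lemma measurable_massOn_window {a : Ω → ℝ → (Fin d → ℤ) → ℂ}
    (ha : ∀ k : Fin d → ℤ, Measurable fun q : Ω × ℝ => a q.1 q.2 k) (w : ℝ) :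
    Measurable fun q : (Ω × ℝ) × ℝ => massOn (a q.1.1 q.1.2) (Set.Icc q.2 (q.2 + w)) := by
  refine Measurable.tsum fun k => Measurable.ite ?_ ?_ measurable_const
  · exact (measurableSet_le measurable_snd measurable_const).inter
      (measurableSet_le measurable_const (measurable_snd.add_const w))
  · exact (((ha k).comp measurable_fst).nnnorm.coe_nnreal_ennreal).pow_const 2

lemma lintegral_massOn_le_asymMass (ℙ : Measure Ω) [SFinite ℙ]
    {a : Ω → ℝ → (Fin d → ℤ) → ℂ}
    (ha : ∀ k : Fin d → ℤ, Measurable fun q : Ω × ℝ => a q.1 q.2 k) (w T r : ℝ) :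
    ∫⁻ z, massOn (a z.1 z.2) (Set.Icc r (r + w)) ∂ℙ.prod (volume.restrict (Set.Icc 0 T)) ≤
      asymMass ℙ a (Set.Icc r (r + w)) := by
  have hW : Measurable fun z : Ω × ℝ => massOn (a z.1 z.2) (Set.Icc r (r + w)) :=
    (measurable_massOn_window ha w).comp (measurable_id.prodMk measurable_const)
  rw [lintegral_prod _ hW.aemeasurable]
  exact lintegral_mono fun ω => lintegral_mono_set Set.Icc_subset_Ici_self

lemma lintegral_window_rpow_le (ℙ : Measure Ω) [IsProbabilityMeasure ℙ] {ν L w p T : ℝ}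
    {g : (Fin d → ℤ) → ℂ} {v : Ω → ℝ → (Fin d → ℤ) → Fin d → ℂ}
    {a : Ω → ℝ → (Fin d → ℤ) → ℂ} {X : Ω → ℝ → ℝ} (hν : 0 ≤ ν) (hL : 0 ≤ L)
    (ha : ∀ k : Fin d → ℤ, Measurable fun q : Ω × ℝ => a q.1 q.2 k)
    (hX : Measurable fun q : Ω × ℝ => X q.1 q.2)
    (hpath : ∀ᵐ ω ∂ℙ, ControlledPath ν L g (v ω) (a ω) (X ω))
    (hmom : ∀ t, 0 ≤ t → ∫⁻ ω, ENNReal.ofReal (X ω t ^ p) ∂ℙ ≤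
      ∫⁻ ω, ENNReal.ofReal (X ω 0 ^ p) ∂ℙ) (A B : ℝ) :
    ∫⁻ r in Set.Icc A B, ∫⁻ z, ENNReal.ofReal (X z.1 z.2 ^ p) *
        massOn (a z.1 z.2) (Set.Icc r (r + w)) ∂ℙ.prod (volume.restrict (Set.Icc 0 T)) ≤
      ENNReal.ofReal (min (B - A) w) *
        (ENNReal.ofReal T * ∫⁻ ω, ENNReal.ofReal (X ω 0 ^ p) ∂ℙ) := by
  have hXp : Measurable fun z : Ω × ℝ => ENNReal.ofReal (X z.1 z.2 ^ p) :=
    (hX.pow_const p).ennreal_ofReal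
  have hW := measurable_massOn_window ha w
  have hin : Measurable fun z : Ω × ℝ => ∫⁻ r in Set.Icc A B,
      massOn (a z.1 z.2) (Set.Icc r (r + w)) := hW.lintegral_prod_right'
  rw [lintegral_lintegral_swap (((hXp.comp measurable_snd).mul
    (hW.comp measurable_swap)).aemeasurable)]
  have h1 : ∀ z : Ω × ℝ, ∫⁻ r in Set.Icc A B, ENNReal.ofReal (X z.1 z.2 ^ p) *
      massOn (a z.1 z.2) (Set.Icc r (r + w)) = ENNReal.ofReal (X z.1 z.2 ^ p) *
        ∫⁻ r in Set.Icc A B, massOn (a z.1 z.2) (Set.Icc r (r + w)) := fun z =>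
    lintegral_const_mul _ (hW.comp (measurable_const.prodMk measurable_id))
  simp_rw [h1]
  have hprod : Measurable fun z : Ω × ℝ => ENNReal.ofReal (X z.1 z.2 ^ p) *
      ∫⁻ r in Set.Icc A B, massOn (a z.1 z.2) (Set.Icc r (r + w)) := hXp.mul hin
  rw [lintegral_prod _ hprod.aemeasurable]
  calc _ ≤ ∫⁻ ω, (∫⁻ t in Set.Icc 0 T, ENNReal.ofReal (X ω t ^ p) *
        ENNReal.ofReal (min (B - A) w)) ∂ℙ := by
        refine lintegral_mono_ae (hpath.mono fun ω h => ?_)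
        refine setLIntegral_mono' measurableSet_Icc fun t ht => ?_
        exact mul_le_mul_right (lintegral_massOn_window_le (a ω t)
          (h.massOn_le_one hν hL ht.1) A B) _
    _ = ∫⁻ t in Set.Icc 0 T, (∫⁻ ω, ENNReal.ofReal (X ω t ^ p) *
        ENNReal.ofReal (min (B - A) w) ∂ℙ) :=
        lintegral_lintegral_swap (hXp.mul_const _).aemeasurable
    _ ≤ ∫⁻ _ in Set.Icc (0 : ℝ) T, (∫⁻ ω, ENNReal.ofReal (X ω 0 ^ p) ∂ℙ) *
        ENNReal.ofReal (min (B - A) w) := by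
        refine setLIntegral_mono' measurableSet_Icc fun t ht => ?_
        rw [lintegral_mul_const' _ _ ENNReal.ofReal_ne_top]
        exact mul_le_mul_left (hmom t ht.1) _
    _ = _ := by
        rw [setLIntegral_const, Real.volume_Icc, sub_zero]
        ring

/-- In expectation, a fixed amount of energy has to cross each sphere up to time `T`, as soon as
dissipation and the remaining energy are small. -/
lemma one_fourth_le_flux (ℙ : Measure Ω) [IsProbabilityMeasure ℙ] {ν L K γ T ρ : ℝ}
    {g : (Fin d → ℤ) → ℂ} {v : Ω → ℝ → (Fin d → ℤ) → Fin d → ℂ}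
    {a : Ω → ℝ → (Fin d → ℤ) → ℂ} {X : Ω → ℝ → ℝ} (hν : 0 ≤ ν) (hL : 0 ≤ L) (hρ : 0 ≤ ρ)
    (hT : 0 < T) (ha : ∀ k : Fin d → ℤ, Measurable fun q : Ω × ℝ => a q.1 q.2 k)
    (hX : Measurable fun q : Ω × ℝ => X q.1 q.2)
    (hpath : ∀ᵐ ω ∂ℙ, ControlledPath ν L g (v ω) (a ω) (X ω))
    (hmix : (∫⁻ ω, (∑' k : Fin d → ℤ, if k = 0 then 0 else
        (ENNReal.ofReal ((2 * π * znorm k) ^ 2))⁻¹ * (‖a ω T k‖₊ : ℝ≥0∞) ^ 2) ∂ℙ)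
      ≤ ENNReal.ofReal (K * Real.exp (-γ * T)))
    (hinit : 3 / 4 ≤ ballMass g ρ) (hdiss : 8 * π ^ 2 * ν * ρ ^ 2 * T ≤ 1 / 4)
    (hrem : (2 * π * ρ) ^ 2 * (K * Real.exp (-γ * T)) ≤ 1 / 4) :
    ENNReal.ofReal (1 / 4) ≤ ENNReal.ofReal (fluxConst d L * ρ) *
      ∫⁻ z, ENNReal.ofReal (X z.1 z.2) * massOn (a z.1 z.2) (Set.Icc (ρ - L) (ρ + L))
        ∂ℙ.prod (volume.restrict (Set.Icc 0 T)) := by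
  have hF : Measurable fun z : Ω × ℝ =>
      ENNReal.ofReal (X z.1 z.2) * massOn (a z.1 z.2) (Set.Icc (ρ - L) (ρ + L)) := by
    have h := (measurable_massOn_window ha (2 * L)).comp
      (measurable_id.prodMk (measurable_const (a := ρ - L)))
    have h2 : ρ - L + 2 * L = ρ + L := by ring
    simp only [Function.comp_def, id, h2] at h
    exact hX.ennreal_ofReal.mul h
  have hFt : Measurable fun ω : Ω => ∫⁻ t in Set.Icc 0 T,
      ENNReal.ofReal (X ω t) * massOn (a ω t) (Set.Icc (ρ - L) (ρ + L)) :=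
    hF.lintegral_prod_right'
  have hball : ∫⁻ ω, ENNReal.ofReal (ballMass (a ω T) ρ) ∂ℙ ≤ ENNReal.ofReal (1 / 4) := by
    calc _ ≤ ∫⁻ ω, ENNReal.ofReal ((2 * π * ρ) ^ 2) *
          (∑' k : Fin d → ℤ, if k = 0 then 0 else
            (ENNReal.ofReal ((2 * π * znorm k) ^ 2))⁻¹ * (‖a ω T k‖₊ : ℝ≥0∞) ^ 2) ∂ℙ :=
          lintegral_mono_ae (hpath.mono fun ω h => h.ballMass_le_mul_tsum hT.le)
      _ ≤ ENNReal.ofReal ((2 * π * ρ) ^ 2) * ENNReal.ofReal (K * Real.exp (-γ * T)) := by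
          rw [lintegral_const_mul' _ _ ENNReal.ofReal_ne_top]
          exact mul_le_mul_right hmix _
      _ ≤ _ := by
          rw [← ENNReal.ofReal_mul (by positivity)]
          exact ENNReal.ofReal_le_ofReal hrem
  have key : ENNReal.ofReal (3 / 4) ≤ ENNReal.ofReal (1 / 4) + ENNReal.ofReal (1 / 4) +
      ENNReal.ofReal (fluxConst d L * ρ) *
      ∫⁻ z, ENNReal.ofReal (X z.1 z.2) * massOn (a z.1 z.2) (Set.Icc (ρ - L) (ρ + L))
        ∂ℙ.prod (volume.restrict (Set.Icc 0 T)) := by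
    calc ENNReal.ofReal (3 / 4) = ∫⁻ _, ENNReal.ofReal (3 / 4) ∂ℙ := by simp
      _ ≤ ∫⁻ ω, (ENNReal.ofReal (ballMass (a ω T) ρ) +
          ENNReal.ofReal (1 / 4) +
          ENNReal.ofReal (fluxConst d L * ρ) * ∫⁻ t in Set.Icc 0 T,
            ENNReal.ofReal (X ω t) * massOn (a ω t) (Set.Icc (ρ - L) (ρ + L))) ∂ℙ := by
          refine lintegral_mono_ae (hpath.mono fun ω h => ?_)
          refine (ENNReal.ofReal_le_ofReal hinit).trans ((h.ballMass_init_le hν hL hρ hT).trans ?_)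
          gcongr
      _ ≤ _ := by
          rw [lintegral_add_right _ (hFt.const_mul _), lintegral_add_right _ measurable_const,
            lintegral_const_mul _ hFt, lintegral_prod _ hF.aemeasurable, lintegral_const,
            measure_univ, mul_one]
          gcongr
  have h34 : ENNReal.ofReal (3 / 4) =
      ENNReal.ofReal (1 / 4) + ENNReal.ofReal (1 / 4) + ENNReal.ofReal (1 / 4) := by
    rw [← ENNReal.ofReal_add (by norm_num) (by norm_num),
      ← ENNReal.ofReal_add (by norm_num) (by norm_num)]
    norm_num
  rw [h34] at key
  exact (ENNReal.add_le_add_iff_left (by simp)).1 key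

lemma three_fourths_le_ballMass {g : (Fin d → ℤ) → ℂ} {s ρ : ℝ}
    (hg : (∑' k : Fin d → ℤ, (‖g k‖₊ : ℝ≥0∞) ^ 2) = 1)
    (hs : massOn g (Set.Ici s) ≤ ENNReal.ofReal (1 / 4)) (hsρ : s ≤ ρ) :
    3 / 4 ≤ ballMass g ρ := by
  have hb : 0 ≤ ballMass g ρ := Finset.sum_nonneg fun _ _ => sq_nonneg _
  have h : ENNReal.ofReal 1 ≤ ENNReal.ofReal (ballMass g ρ + 1 / 4) := by
    rw [ENNReal.ofReal_add hb (by norm_num), ENNReal.ofReal_one, ← massOn_Iic_eq_ballMass, ← hg]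
    refine le_trans ?_ (add_le_add_right hs _)
    rw [massOn, massOn, ← ENNReal.tsum_add]
    refine ENNReal.tsum_le_tsum fun k => ?_
    rcases le_total (znorm k) ρ with hk | hk
    · rw [if_pos (show znorm k ∈ Set.Iic ρ from hk)]
      exact le_self_add
    · rw [if_pos (show znorm k ∈ Set.Ici s from hsρ.trans hk)]
      exact le_add_self
  rw [ENNReal.ofReal_le_ofReal_iff (by positivity)] at h
  linarith

/-- A radius carrying little mass forces the `p`-th moment of the velocity to act on it. -/
lemma inv_le_of_undercharged (ℙ : Measure Ω) [IsProbabilityMeasure ℙ] {L T p r A α : ℝ}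
    {a : Ω → ℝ → (Fin d → ℤ) → ℂ} {X : Ω → ℝ → ℝ} (hL : 1 ≤ L) (hA : 1 ≤ A) (hp : 1 ≤ p)
    (hLr : L ≤ r) (hα : 0 < α)
    (ha : ∀ k : Fin d → ℤ, Measurable fun q : Ω × ℝ => a q.1 q.2 k)
    (hX : Measurable fun q : Ω × ℝ => X q.1 q.2) (hX1 : ∀ ω t, 1 ≤ X ω t)
    (hflux : ENNReal.ofReal (1 / 4) ≤ ENNReal.ofReal (A * (r + L)) *
      ∫⁻ z, ENNReal.ofReal (X z.1 z.2) * massOn (a z.1 z.2) (Set.Icc r (r + 2 * L))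
        ∂ℙ.prod (volume.restrict (Set.Icc 0 T)))
    (hbad : asymMass ℙ a (Set.Icc r (r + 2 * L)) ≤ ENNReal.ofReal (2 * L * α / r)) :
    ENNReal.ofReal r⁻¹ ≤ ENNReal.ofReal (16 * A * (32 * A * L * α) ^ (p - 1)) *
      ∫⁻ z, ENNReal.ofReal (X z.1 z.2 ^ p) * massOn (a z.1 z.2) (Set.Icc r (r + 2 * L))
        ∂ℙ.prod (volume.restrict (Set.Icc 0 T)) := by
  have hr : 0 < r := by linarith
  set Q := ℙ.prod (volume.restrict (Set.Icc (0 : ℝ) T))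
  set W : Ω × ℝ → ℝ≥0∞ := fun z => massOn (a z.1 z.2) (Set.Icc r (r + 2 * L)) with hWdef
  have hW : Measurable W := (measurable_massOn_window ha (2 * L)).comp
    (measurable_id.prodMk measurable_const)
  have hXp : Measurable fun z : Ω × ℝ => ENNReal.ofReal (X z.1 z.2 ^ p) :=
    (hX.pow_const p).ennreal_ofReal
  have hm : 0 < 32 * A * L * α := by positivity
  set lam := (32 * A * L * α)⁻¹ with hlam
  have hlam0 : 0 < lam := inv_pos.2 hm
  have hlamp : lam ^ (1 - p) = (32 * A * L * α) ^ (p - 1) := by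
    rw [hlam, Real.inv_rpow hm.le, ← Real.rpow_neg hm.le, neg_sub]
  have hZ : ∫⁻ z, W z ∂Q ≤ ENNReal.ofReal (2 * L * α / r) :=
    (lintegral_massOn_le_asymMass ℙ ha (2 * L) T r).trans hbad
  set V := ∫⁻ z, ENNReal.ofReal (X z.1 z.2 ^ p) * W z ∂Q
  have h1 : ∫⁻ z, ENNReal.ofReal (X z.1 z.2) * W z ∂Q ≤
      ENNReal.ofReal lam * ENNReal.ofReal (2 * L * α / r) +
        ENNReal.ofReal (lam ^ (1 - p)) * V := by
    calc _ ≤ ∫⁻ z, (ENNReal.ofReal lam * W z + ENNReal.ofReal (lam ^ (1 - p)) *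
          (ENNReal.ofReal (X z.1 z.2 ^ p) * W z)) ∂Q := by
          refine lintegral_mono fun z => ?_
          rw [← mul_assoc, ← add_mul]
          exact mul_le_mul_left (ofReal_le_add_rpow (hX1 _ _) hlam0 hp) _
      _ = ENNReal.ofReal lam * ∫⁻ z, W z ∂Q + ENNReal.ofReal (lam ^ (1 - p)) * V := by
          have hXW : Measurable fun z : Ω × ℝ => ENNReal.ofReal (X z.1 z.2 ^ p) * W z :=
            hXp.mul hW
          rw [lintegral_add_left (hW.const_mul _), lintegral_const_mul _ hW,
            lintegral_const_mul _ hXW]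
      _ ≤ _ := by gcongr
  have h2 : ENNReal.ofReal (1 / 8) + ENNReal.ofReal (1 / 8) ≤ ENNReal.ofReal (1 / 8) +
      ENNReal.ofReal (2 * A * r * lam ^ (1 - p)) * V := by
    calc _ = ENNReal.ofReal (1 / 4) := by
          rw [← ENNReal.ofReal_add (by norm_num) (by norm_num)]; norm_num
      _ ≤ ENNReal.ofReal (2 * A * r) * (ENNReal.ofReal lam * ENNReal.ofReal (2 * L * α / r) +
        ENNReal.ofReal (lam ^ (1 - p)) * V) := by
          refine hflux.trans (mul_le_mul' (ENNReal.ofReal_le_ofReal ?_) h1)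
          nlinarith
      _ = _ := by
          rw [mul_add, ← mul_assoc _ _ V, ← ENNReal.ofReal_mul hlam0.le,
            ← ENNReal.ofReal_mul (by positivity), ← ENNReal.ofReal_mul (by positivity)]
          congr 2
          rw [hlam]
          field_simp
          norm_num
  have h3 := (ENNReal.add_le_add_iff_left (by simp)).1 h2
  calc ENNReal.ofReal r⁻¹ = ENNReal.ofReal (8 / r) * ENNReal.ofReal (1 / 8) := by
        rw [← ENNReal.ofReal_mul (by positivity)]
        congr 1
        field_simp
    _ ≤ ENNReal.ofReal (8 / r) * (ENNReal.ofReal (2 * A * r * lam ^ (1 - p)) * V) := by gcongr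
    _ = _ := by
        rw [← mul_assoc, ← ENNReal.ofReal_mul (by positivity), ← hlamp]
        congr 2
        field_simp
        norm_num

end Expectation

lemma log_le_two_mul_sqrt {x : ℝ} (hx : 0 < x) : Real.log x ≤ 2 * √x := by
  have h := Real.log_le_sub_one_of_pos (Real.sqrt_pos.2 hx)
  rw [Real.log_sqrt hx.le] at h
  linarith

lemma min_mul_log_le {C L R : ℝ} (hC : 2 ≤ C) (hLC : L ≤ C) (hCR : C < R) :
    min (R - C) (2 * L) * Real.log R ≤ 12 * C * √C * Real.log (R / C) := by
  have hC0 : 0 < C := by linarith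
  have hR0 : 0 < R := by linarith
  have hs1 : 1 ≤ √C := Real.one_le_sqrt.2 (by linarith)
  have hlogR : Real.log R = Real.log C + Real.log (R / C) := by
    rw [Real.log_div hR0.ne' hC0.ne']; ring
  have hlogC := log_le_two_mul_sqrt hC0
  have hlogC0 : 0 ≤ Real.log C := Real.log_nonneg (by linarith)
  have hlogR0 : 0 ≤ Real.log R := Real.log_nonneg (by linarith)
  have hl2 := Real.log_two_gt_d9
  rcases le_total R (2 * C) with h | h
  · have h1 : (R - C) / (2 * C) ≤ Real.log (R / C) := by
      have h2 := Real.one_sub_inv_le_log_of_pos (div_pos hR0 hC0)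
      refine le_trans ?_ h2
      rw [inv_div, one_sub_div hR0.ne']
      exact div_le_div_of_nonneg_left (by linarith) hR0 h
    rw [div_le_iff₀ (by positivity)] at h1
    have h2 : Real.log R ≤ 4 * √C := by
      have h3 := Real.log_le_log hR0 h
      rw [Real.log_mul two_ne_zero hC0.ne'] at h3
      linarith [Real.log_two_lt_d9]
    have hl : 0 ≤ Real.log (R / C) := Real.log_nonneg ((one_le_div hC0).2 hCR.le)
    calc _ ≤ (R - C) * Real.log R := mul_le_mul_of_nonneg_right (min_le_left _ _) hlogR0
      _ ≤ (Real.log (R / C) * (2 * C)) * (4 * √C) := by gcongr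
      _ = 8 * (C * √C * Real.log (R / C)) := by ring
      _ ≤ 12 * (C * √C * Real.log (R / C)) :=
          mul_le_mul_of_nonneg_right (by norm_num) (by positivity)
      _ = _ := by ring
  · have h1 : 1 / 2 ≤ Real.log (R / C) := by
      have h2 : Real.log 2 ≤ Real.log (R / C) :=
        Real.log_le_log two_pos ((le_div_iff₀ hC0).2 h)
      linarith
    have h2 : Real.log R ≤ 6 * √C * Real.log (R / C) := by
      rw [hlogR]; nlinarith
    calc _ ≤ 2 * L * Real.log R := mul_le_mul_of_nonneg_right (min_le_right _ _) hlogR0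
      _ ≤ 2 * C * (6 * √C * Real.log (R / C)) := by gcongr
      _ = _ := by ring

lemma rpow_mul_le_rpow {C D γ p : ℝ} (hD : 1 ≤ D) (hp : 2 ≤ p) (hDC : D ≤ C)
    (hC : (36 * D ^ 2 / γ) ^ 2 ≤ C) : D ^ p * (3 / γ) * (12 * C * √C) ≤ C ^ p := by
  have hC0 : 0 < C := by linarith
  have hs : 36 * D ^ 2 / γ ≤ √C := Real.le_sqrt_of_sq_le hC
  have h1 : (C / D) ^ (2 : ℝ) ≤ (C / D) ^ p :=
    Real.rpow_le_rpow_of_exponent_le ((one_le_div (by linarith)).2 hDC) hp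
  rw [Real.rpow_two, Real.div_rpow hC0.le (by linarith), div_pow,
    div_le_div_iff₀ (by positivity) (by positivity)] at h1
  have h2 : 36 * D ^ 2 / γ * (C * √C) ≤ C ^ 2 := by
    calc _ ≤ √C * (C * √C) := by gcongr
      _ = C * (√C * √C) := by ring
      _ = _ := by rw [Real.mul_self_sqrt hC0.le]; ring
  have hD2 : 0 < D ^ 2 := by positivity
  refine le_of_mul_le_mul_right ?_ hD2
  calc D ^ p * (3 / γ) * (12 * C * √C) * D ^ 2 = 36 * D ^ 2 / γ * (C * √C) * D ^ p := by ring
    _ ≤ C ^ 2 * D ^ p := by gcongr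
    _ ≤ _ := h1

/-- In the inertial range, dissipation up to times of order `log R` is negligible. -/
lemma mul_sq_mul_log_le {ν C R : ℝ} (hν : 0 < ν) (hν1 : ν ≤ Real.exp (-1)) (hC : 1 ≤ C)
    (hR : 1 ≤ R) (h : R ≤ ν ^ (-(1 / 2) : ℝ) / (C * √(Real.log ν⁻¹))) :
    ν * R ^ 2 * Real.log R ≤ 1 / C := by
  have hl : 1 ≤ Real.log ν⁻¹ := by
    rw [Real.log_inv]
    have := Real.log_le_log hν hν1
    rw [Real.log_exp] at this
    linarith
  have hl0 : 0 < Real.log ν⁻¹ := by linarith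
  have hs : 1 ≤ √(Real.log ν⁻¹) := Real.one_le_sqrt.2 hl
  have hνpow : ν ^ (-(1 / 2) : ℝ) = (√ν)⁻¹ := by
    rw [Real.rpow_neg hν.le, Real.sqrt_eq_rpow]
  have hsν : 0 < √ν := Real.sqrt_pos.2 hν
  rw [hνpow, le_div_iff₀ (by positivity)] at h
  have h1 : √ν * R * (C * √(Real.log ν⁻¹)) ≤ 1 := by
    calc _ = √ν * (R * (C * √(Real.log ν⁻¹))) := by ring
      _ ≤ √ν * (√ν)⁻¹ := by gcongr
      _ = 1 := mul_inv_cancel₀ hsν.ne'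
  have h2 : ν * R ^ 2 * (C ^ 2 * Real.log ν⁻¹) ≤ 1 := by
    have h3 := pow_le_one₀ (n := 2) (by positivity) h1
    calc _ = (√ν * R * (C * √(Real.log ν⁻¹))) ^ 2 := by
          rw [mul_pow, mul_pow, mul_pow, Real.sq_sqrt hν.le, Real.sq_sqrt hl0.le]
      _ ≤ 1 := h3
  have hRν : R ≤ ν⁻¹ := by
    have h3 : √ν * R ≤ 1 := by
      refine le_trans ?_ h1
      exact le_mul_of_one_le_right (by positivity) (one_le_mul_of_one_le_of_one_le hC hs)
    have hν2 : √ν ≤ 1 := Real.sqrt_le_one.2 (hν1.trans (Real.exp_le_one_iff.2 (by norm_num)))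
    rw [← one_div, le_div_iff₀ hν]
    calc R * ν = √ν * (√ν * R) := by
          rw [← mul_assoc, Real.mul_self_sqrt hν.le]; ring
      _ ≤ 1 * 1 := by gcongr
      _ = 1 := one_mul 1
  have hlog : Real.log R ≤ Real.log ν⁻¹ := Real.log_le_log (by linarith) hRν
  rw [le_div_iff₀ (by linarith)]
  calc ν * R ^ 2 * Real.log R * C ≤ ν * R ^ 2 * Real.log ν⁻¹ * C ^ 2 := by
        have : C ≤ C ^ 2 := by nlinarith
        gcongr
    _ = ν * R ^ 2 * (C ^ 2 * Real.log ν⁻¹) := by ring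
    _ ≤ 1 := h2

lemma controlledPath_of_advectionSetup {d : ℕ} {Ω : Type*} [MeasurableSpace Ω] {ℙ : Measure Ω}
    {ν K γ L : ℝ} {v : Ω → ℝ → (Fin d → ℤ) → Fin d → ℂ} {a : Ω → ℝ → (Fin d → ℤ) → ℂ}
    {g : (Fin d → ℤ) → ℂ} {X : Ω → ℝ → ℝ} (h : AdvectionSetup ℙ ν K γ v a g)
    (hX1 : ∀ ω t, 1 ≤ X ω t)
    (hv : ∀ᵐ ω ∂ℙ, ∀ t : ℝ, 0 ≤ t → ∀ k : Fin d → ℤ,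
      cnorm (v ω t k) ≤ if znorm k ≤ L then X ω t else 0)
    (hint : ∀ᵐ ω ∂ℙ, ∀ T > (0 : ℝ), IntegrableOn (fun t => X ω t) (Set.Icc 0 T)) :
    ∀ᵐ ω ∂ℙ, ControlledPath ν L g (v ω) (a ω) (X ω) := by
  obtain ⟨-, -, hg0, hg1, hpath, -⟩ := h
  filter_upwards [hpath, hv, hint] with ω ⟨h1, h2, h3, h4⟩ h5 h6
  exact ⟨fun t ht => (h1 t ht).1, fun t ht => (h1 t ht).2, h2, h3, h4, hg0, hg1, hX1 ω, h5, h6⟩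

/-- for velocities with compact Fourier support of radius `L` and random
magnitude `X` with `p`-th moment bounds, the annuli `[r, r+2L]` undercharged below
`2Lα/r` have logarithmic density at most `C^p (𝔼 X₀^p) α^{p-1}`. -/
theorem compact_support_moment_density_bound (d : ℕ) (hd : 1 ≤ d)
    (K γ L N₀ : ℝ) (hK : 1 ≤ K) (hγ : 0 < γ) (hL : 1 ≤ L) :
    ∃ C : ℝ, 2 ≤ C ∧
      ∀ (ν : ℝ), 0 < ν → ν ≤ Real.exp (-1) →
      ∀ (Ω : Type) [MeasurableSpace Ω] (ℙ : Measure Ω) [IsProbabilityMeasure ℙ]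
        (v : Ω → ℝ → (Fin d → ℤ) → Fin d → ℂ) (a : Ω → ℝ → (Fin d → ℤ) → ℂ)
        (g : (Fin d → ℤ) → ℂ) (X : Ω → ℝ → ℝ) (p : ℝ), 2 ≤ p →
      AdvectionSetup ℙ ν K γ v a g →
      N₀ = sInf {s : ℝ | 1 ≤ s ∧ massOn g (Set.Ici s) ≤ ENNReal.ofReal (1 / 4)} →
      (∃ s : ℝ, 1 ≤ s ∧ massOn g (Set.Ici s) ≤ ENNReal.ofReal (1 / 4)) →
      Measurable (fun pr : Ω × ℝ => X pr.1 pr.2) →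
      (∀ (ω : Ω) (t : ℝ), 1 ≤ X ω t) →
      (∀ᵐ ω ∂ℙ, ∀ t : ℝ, 0 ≤ t → ∀ k : Fin d → ℤ,
        cnorm (v ω t k) ≤ if znorm k ≤ L then X ω t else 0) →
      (∀ᵐ ω ∂ℙ, ∀ T > (0 : ℝ), IntegrableOn (fun t => X ω t) (Set.Icc 0 T)) →
      (∀ t : ℝ, 0 ≤ t →
        (∫⁻ ω, ENNReal.ofReal (X ω t ^ p) ∂ℙ) ≤ ∫⁻ ω, ENNReal.ofReal (X ω 0 ^ p) ∂ℙ) →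
      (∫⁻ ω, ENNReal.ofReal (X ω 0 ^ p) ∂ℙ) ≠ ⊤ →
      ∀ R α : ℝ, C ≤ R → R ≤ ν ^ (-(1 / 2) : ℝ) / (C * Real.sqrt (Real.log ν⁻¹)) → 0 < α →
        logDensity C R {r : ℝ | C ≤ r ∧ r ≤ R ∧
            asymMass ℙ a (Set.Icc r (r + 2 * L)) ≤ ENNReal.ofReal (2 * L * α / r)}
          ≤ ENNReal.ofReal (C ^ p) * (∫⁻ ω, ENNReal.ofReal (X ω 0 ^ p) ∂ℙ) *
            ENNReal.ofReal (α ^ (p - 1)) := by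
  set A := fluxConst d L with hAdef
  have hA : 1 ≤ A := one_le_fluxConst d (by linarith)
  set D := 32 * A * L with hDdef
  have hD : 1 ≤ D := by nlinarith
  have hpi := Real.pi_pos
  obtain ⟨C, hC2, hCN, hCL, hCK, hCγ, hCD, hCs⟩ : ∃ C : ℝ, 2 ≤ C ∧ N₀ + 1 ≤ C ∧ L ≤ C ∧
      64 * π ^ 2 * K ≤ C ∧ 384 * π ^ 2 / γ ≤ C ∧ D ≤ C ∧ (36 * D ^ 2 / γ) ^ 2 ≤ C := by
    have h1 : 0 ≤ 64 * π ^ 2 * K := by positivity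
    have h2 : 0 ≤ 384 * π ^ 2 / γ := by positivity
    have h3 : 0 ≤ (36 * D ^ 2 / γ) ^ 2 := by positivity
    have h4 := abs_nonneg N₀
    have h5 := le_abs_self N₀
    refine ⟨2 + |N₀| + L + 64 * π ^ 2 * K + 384 * π ^ 2 / γ + D + (36 * D ^ 2 / γ) ^ 2,
      ?_, ?_, ?_, ?_, ?_, ?_, ?_⟩ <;> linarith
  refine ⟨C, hC2, ?_⟩
  intro ν hν hν1 Ω _ ℙ _ v a g X p hp hset hN₀ hne hX hX1 hv hint hmom _ R α hCR hR hα
  have hpath := controlledPath_of_advectionSetup hset hX1 hv hint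
  obtain ⟨ha, -, -, hg1, -, hmix⟩ := hset
  have hC0 : 0 < C := by linarith
  have hR0 : 0 < R := by linarith
  have hlogR : 0 < Real.log R := Real.log_pos (by linarith)
  set T := 3 * Real.log R / γ with hTdef
  have hT : 0 < T := by positivity
  have hexp : Real.exp (-γ * T) = (R ^ 3)⁻¹ := by
    have h1 : -γ * T = -(3 * Real.log R) := by rw [hTdef]; field_simp
    rw [h1, Real.exp_neg, mul_comm, Real.exp_mul, Real.exp_log hR0]
    norm_cast
  set M := ∫⁻ ω, ENNReal.ofReal (X ω 0 ^ p) ∂ℙ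
  have hflux : ∀ r, C ≤ r → r ≤ R → ENNReal.ofReal (1 / 4) ≤ ENNReal.ofReal (A * (r + L)) *
      ∫⁻ z, ENNReal.ofReal (X z.1 z.2) * massOn (a z.1 z.2) (Set.Icc r (r + 2 * L))
        ∂ℙ.prod (volume.restrict (Set.Icc 0 T)) := fun r hCr hrR => by
    have hinit : 3 / 4 ≤ ballMass g (r + L) := by
      obtain ⟨s, hs, hsN⟩ := exists_lt_of_csInf_lt
        (s := {s : ℝ | 1 ≤ s ∧ massOn g (Set.Ici s) ≤ ENNReal.ofReal (1 / 4)}) hne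
        (show _ < N₀ + 1 by rw [← hN₀]; linarith)
      exact three_fourths_le_ballMass hg1 hs.2 (by linarith)
    have hρ : r + L ≤ 2 * R := by linarith
    have hρ0 : 0 ≤ r + L := by linarith
    have hdiss : 8 * π ^ 2 * ν * (r + L) ^ 2 * T ≤ 1 / 4 := by
      have h1 := mul_sq_mul_log_le hν hν1 (by linarith) (by linarith) hR
      calc _ ≤ 8 * π ^ 2 * ν * (2 * R) ^ 2 * T := by gcongr
        _ = 96 * π ^ 2 / γ * (ν * R ^ 2 * Real.log R) := by rw [hTdef]; ring
        _ ≤ 96 * π ^ 2 / γ * (1 / C) := by gcongr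
        _ = (384 * π ^ 2 / γ) / C / 4 := by ring
        _ ≤ 1 / 4 := by
          have := (div_le_one hC0).2 hCγ
          linarith
    have hrem : (2 * π * (r + L)) ^ 2 * (K * Real.exp (-γ * T)) ≤ 1 / 4 := by
      rw [hexp]
      calc _ ≤ (2 * π * (2 * R)) ^ 2 * (K * (R ^ 3)⁻¹) := by gcongr
        _ = (64 * π ^ 2 * K) / R / 4 := by field_simp; ring
        _ ≤ 1 / 4 := by
          have := (div_le_one hR0).2 (hCK.trans hCR)
          linarith
    have h := one_fourth_le_flux ℙ hν.le (by linarith) hρ0 hT ha hX hpath (hmix T hT.le)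
      hinit hdiss hrem
    have e1 : r + L - L = r := by ring
    have e2 : r + L + L = r + 2 * L := by ring
    rwa [e1, e2] at h
  rcases hCR.eq_or_lt with rfl | hCR'
  · rw [logDensity, setLIntegral_measure_zero _ _
      (measure_mono_null Set.inter_subset_right (by simp)), mul_zero]
    exact zero_le
  have hℓ : 0 < Real.log (R / C) := Real.log_pos ((one_lt_div hC0).2 hCR')
  set F : ℝ → ℝ≥0∞ := fun r => ∫⁻ z, ENNReal.ofReal (X z.1 z.2 ^ p) *
    massOn (a z.1 z.2) (Set.Icc r (r + 2 * L)) ∂ℙ.prod (volume.restrict (Set.Icc 0 T))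
  have hFmeas : Measurable F := by
    have h : Measurable fun q : ℝ × (Ω × ℝ) => ENNReal.ofReal (X q.2.1 q.2.2 ^ p) *
        massOn (a q.2.1 q.2.2) (Set.Icc q.1 (q.1 + 2 * L)) :=
      ((hX.pow_const p).ennreal_ofReal.comp measurable_snd).mul
        ((measurable_massOn_window ha (2 * L)).comp measurable_swap)
    exact h.lintegral_prod_right'
  set c := 16 * A * (D * α) ^ (p - 1) with hc
  have hbad : ∫⁻ r in {r : ℝ | C ≤ r ∧ r ≤ R ∧
      asymMass ℙ a (Set.Icc r (r + 2 * L)) ≤ ENNReal.ofReal (2 * L * α / r)} ∩ Set.Icc C R,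
      ENNReal.ofReal r⁻¹ ≤
      ENNReal.ofReal c * (ENNReal.ofReal (min (R - C) (2 * L)) * (ENNReal.ofReal T * M)) := by
    calc _ ≤ ∫⁻ r in {r : ℝ | C ≤ r ∧ r ≤ R ∧
          asymMass ℙ a (Set.Icc r (r + 2 * L)) ≤ ENNReal.ofReal (2 * L * α / r)} ∩ Set.Icc C R,
          ENNReal.ofReal c * F r :=
          setLIntegral_mono (hFmeas.const_mul _) fun r hr =>
            inv_le_of_undercharged ℙ hL hA (by linarith) (by linarith [hr.1.1]) hα ha hX hX1
              (hflux r hr.1.1 hr.1.2.1) hr.1.2.2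
      _ ≤ ∫⁻ r in Set.Icc C R, ENNReal.ofReal c * F r :=
          lintegral_mono_set Set.inter_subset_right
      _ = ENNReal.ofReal c * ∫⁻ r in Set.Icc C R, F r := lintegral_const_mul _ hFmeas
      _ ≤ _ := by
          gcongr
          exact lintegral_window_rpow_le ℙ hν.le (by linarith) ha hX hpath hmom C R
  have hH : 0 ≤ min (R - C) (2 * L) := le_min (by linarith) (by linarith)
  have hnum : c * (min (R - C) (2 * L) * T) ≤ Real.log (R / C) * (C ^ p * α ^ (p - 1)) := by
    have hD0 : 0 < D := by linarith
    have h1 : 16 * A * D ^ (p - 1) ≤ D ^ p := by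
      have h2 : D ^ p = D * D ^ (p - 1) := by
        rw [← Real.rpow_one_add' hD0.le (by linarith)]; congr 1; ring
      have h3 : 16 * A ≤ D := by rw [hDdef]; nlinarith
      rw [h2]
      gcongr
    have h2 := min_mul_log_le hC2 hCL hCR'
    have h3 := rpow_mul_le_rpow hD hp hCD hCs
    calc _ = 16 * A * D ^ (p - 1) * (3 / γ) * α ^ (p - 1) *
          (min (R - C) (2 * L) * Real.log R) := by
          rw [hc, hTdef, Real.mul_rpow hD0.le hα.le]; ring
      _ ≤ D ^ p * (3 / γ) * α ^ (p - 1) * (12 * C * √C * Real.log (R / C)) := by gcongr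
      _ = D ^ p * (3 / γ) * (12 * C * √C) * (α ^ (p - 1) * Real.log (R / C)) := by ring
      _ ≤ C ^ p * (α ^ (p - 1) * Real.log (R / C)) := by gcongr
      _ = _ := by ring
  have hc0 : 0 ≤ c := by positivity
  rw [logDensity, ENNReal.inv_mul_le_iff (by simpa using hℓ) ENNReal.ofReal_ne_top]
  calc _ ≤ _ := hbad
    _ = ENNReal.ofReal (c * (min (R - C) (2 * L) * T)) * M := by
        rw [ENNReal.ofReal_mul hc0, ENNReal.ofReal_mul hH]; ring
    _ ≤ ENNReal.ofReal (Real.log (R / C) * (C ^ p * α ^ (p - 1))) * M := by gcongr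
    _ = _ := by
        rw [ENNReal.ofReal_mul hℓ.le, ENNReal.ofReal_mul (by positivity)]; ring
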